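/- Let G ∈ S_n^{r,t} be a connected bicyclic graph of order n ≥ 16 whose two cycles have lengths r and t and share exactly one common vertex. Then ABC_GG(G) ≤ 2·(sqrt(2) + sqrt((n−4)/(n−3))) + (n−5)·sqrt((n−2)/(n−1)), with equality if and only if G = S_n^{3,3}(1, 1, n−7). -/

import Mathlib

/-- `sideCount G u v` is the number of vertices of `G` whose distance to `u`
is strictly smaller than their distance to `v`. -/
noncomputable def sideCount {V : Type*} [Fintype V] (G : SimpleGraph V) (u v : V) : ℕ :=
  Nat.card {w : V // G.dist w u < G.dist w v}

open Classical in
/-- The Graovac–Ghorbani index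
`ABC_GG(G) = Σ_{uv ∈ E(G)} sqrt ((n_u + n_v - 2) / (n_u * n_v))`,
computed as half the sum over ordered adjacent pairs. -/
noncomputable def ABCGG {V : Type*} [Fintype V] (G : SimpleGraph V) : ℝ :=
  (1 / 2) * ∑ u : V, ∑ v : V,
    if G.Adj u v then
      Real.sqrt (((sideCount G u v : ℝ) + (sideCount G v u : ℝ) - 2) /
        ((sideCount G u v : ℝ) * (sideCount G v u : ℝ)))
    else 0

/-- `G ∈ S_n^{r,t}`: `G` is a bicyclic graph of order `n` possessing two cycles, of
lengths `r` and `t`, sharing exactly one common vertex. -/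
def InSnrt {V : Type*} [Fintype V] (G : SimpleGraph V) (n r t : ℕ) : Prop :=
  Fintype.card V = n ∧ G.Connected ∧ G.edgeSet.ncard = n + 1 ∧
  ∃ (a b : V) (c1 : G.Walk a a) (c2 : G.Walk b b),
    c1.IsCycle ∧ c2.IsCycle ∧ c1.length = r ∧ c2.length = t ∧
    ({v | v ∈ c1.support} ∩ {v | v ∈ c2.support}).ncard = 1

/-- Vertex type for `S_n^{3,3}(m1,m2,n1,n2,m0)`: the five cycle vertices
(`0` = common vertex `u`, `1,2` = the other vertices of the first triangle,
`3,4` = the other vertices of the second triangle) together with the pendent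
vertices. -/
abbrev SVert (m1 m2 n1 n2 m0 : ℕ) : Type :=
  Fin 5 ⊕ Fin m1 ⊕ Fin m2 ⊕ Fin n1 ⊕ Fin n2 ⊕ Fin m0

/-- The graph `S_n^{3,3}(m1,m2,n1,n2,m0)`: two triangles sharing exactly the vertex `u`,
with `m1, m2` pendent vertices attached to the two non-common vertices of the first
triangle, `n1, n2` pendent vertices attached to those of the second triangle, and
`m0` pendent vertices attached to `u`.  `S_n^{3,3}(m1,n1,m0)` is `S33 m1 0 n1 0 m0`. -/
def S33 (m1 m2 n1 n2 m0 : ℕ) : SimpleGraph (SVert m1 m2 n1 n2 m0) :=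
  SimpleGraph.fromRel (fun x y =>
    (x = Sum.inl 0 ∧ y = Sum.inl 1) ∨
    (x = Sum.inl 1 ∧ y = Sum.inl 2) ∨
    (x = Sum.inl 2 ∧ y = Sum.inl 0) ∨
    (x = Sum.inl 0 ∧ y = Sum.inl 3) ∨
    (x = Sum.inl 3 ∧ y = Sum.inl 4) ∨
    (x = Sum.inl 4 ∧ y = Sum.inl 0) ∨
    (∃ i : Fin m1, x = Sum.inl 1 ∧ y = Sum.inr (Sum.inl i)) ∨
    (∃ i : Fin m2, x = Sum.inl 2 ∧ y = Sum.inr (Sum.inr (Sum.inl i))) ∨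
    (∃ i : Fin n1, x = Sum.inl 3 ∧ y = Sum.inr (Sum.inr (Sum.inr (Sum.inl i)))) ∨
    (∃ i : Fin n2, x = Sum.inl 4 ∧ y = Sum.inr (Sum.inr (Sum.inr (Sum.inr (Sum.inl i))))) ∨
    (∃ i : Fin m0, x = Sum.inl 0 ∧ y = Sum.inr (Sum.inr (Sum.inr (Sum.inr (Sum.inr i))))))

/-- The contribution `√((a + b - 2) / (a b))` of an edge whose sides have `a` and `b` vertices. -/
noncomputable def edgeTerm (a b : ℕ) : ℝ :=
  Real.sqrt (((a : ℝ) + (b : ℝ) - 2) / ((a : ℝ) * (b : ℝ)))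

theorem edgeTerm_comm (a b : ℕ) : edgeTerm a b = edgeTerm b a := by
  unfold edgeTerm
  rw [add_comm (a : ℝ), mul_comm (a : ℝ)]

theorem edgeTerm_le_sqrt_half {a b : ℕ} (ha : 2 ≤ a) (hb : 2 ≤ b) :
    edgeTerm a b ≤ Real.sqrt (1 / 2) := by
  have ha' : (2 : ℝ) ≤ a := by exact_mod_cast ha
  have hb' : (2 : ℝ) ≤ b := by exact_mod_cast hb
  apply Real.sqrt_le_sqrt
  rw [div_le_div_iff₀ (by positivity) (by norm_num)]
  nlinarith [mul_nonneg (sub_nonneg.2 ha') (sub_nonneg.2 hb')]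

theorem edgeTerm_one_left (b : ℕ) : edgeTerm 1 b = Real.sqrt (((b : ℝ) - 1) / b) := by
  unfold edgeTerm
  congr 1
  push_cast
  ring

theorem sqrt_sub_one_div_lt {x y : ℝ} (hx : 1 ≤ x) (hxy : x < y) :
    Real.sqrt ((x - 1) / x) < Real.sqrt ((y - 1) / y) := by
  have hx0 : 0 < x := by linarith
  have hy0 : 0 < y := by linarith
  apply Real.sqrt_lt_sqrt (div_nonneg (by linarith) hx0.le)
  rw [div_lt_div_iff₀ hx0 hy0]
  nlinarith

/-- The contribution of a pendent edge in a graph of order `n`. -/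
noncomputable def pendentTerm (n : ℕ) : ℝ := Real.sqrt (((n : ℝ) - 2) / ((n : ℝ) - 1))

theorem sqrt_half_lt : Real.sqrt (1 / 2) < 0.7072 := by
  rw [Real.sqrt_lt' (by norm_num)]
  norm_num

theorem lt_pendentTerm {n : ℕ} (hn : 16 ≤ n) : 0.96 < pendentTerm n := by
  have hn' : (16 : ℝ) ≤ n := by exact_mod_cast hn
  apply Real.lt_sqrt_of_sq_lt
  rw [lt_div_iff₀ (by linarith)]
  linarith

theorem edgeTerm_one_sub_one {n : ℕ} (hn : 1 ≤ n) : edgeTerm 1 (n - 1) = pendentTerm n := by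
  rw [edgeTerm_one_left, pendentTerm]
  push_cast [hn]
  congr 2
  ring

theorem edgeTerm_lt_pendentTerm {a b n : ℕ} (hn : 16 ≤ n) (ha : 1 ≤ a) (hb : 1 ≤ b)
    (hab : a + b ≤ n) (h : ¬ ((a = 1 ∧ b = n - 1) ∨ (b = 1 ∧ a = n - 1))) :
    edgeTerm a b < pendentTerm n := by
  wlog hle : a ≤ b generalizing a b
  · rw [edgeTerm_comm]
    exact this hb ha (by omega) (by tauto) (by omega)
  rcases (by omega : a = 1 ∨ 2 ≤ a) with rfl | ha2
  · rw [edgeTerm_one_left, ← edgeTerm_one_sub_one (by omega), edgeTerm_one_left]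
    apply sqrt_sub_one_div_lt
    · exact_mod_cast hb
    · exact_mod_cast (by omega : b < n - 1)
  · have h1 := edgeTerm_le_sqrt_half ha2 (ha2.trans hle)
    have h2 := sqrt_half_lt
    have h3 := lt_pendentTerm hn
    linarith

theorem edgeTerm_le_pendentTerm {a b n : ℕ} (hn : 16 ≤ n) (ha : 1 ≤ a) (hb : 1 ≤ b)
    (hab : a + b ≤ n) : edgeTerm a b ≤ pendentTerm n := by
  by_cases h : (a = 1 ∧ b = n - 1) ∨ (b = 1 ∧ a = n - 1)
  · rcases h with ⟨rfl, rfl⟩ | ⟨rfl, rfl⟩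
    · exact (edgeTerm_one_sub_one (by omega)).le
    · rw [edgeTerm_comm]
      exact (edgeTerm_one_sub_one (by omega)).le
  · exact (edgeTerm_lt_pendentTerm hn ha hb hab h).le

/-- The largest possible contribution of a triangle in a graph of order `n`. -/
noncomputable def triangleTerm (n : ℕ) : ℝ :=
  Real.sqrt 2 + Real.sqrt (((n : ℝ) - 4) / ((n : ℝ) - 3))

theorem lt_sqrt_two : 1.4142 < Real.sqrt 2 := by
  apply Real.lt_sqrt_of_sq_lt
  norm_num

theorem lt_triangleTerm {n : ℕ} (hn : 16 ≤ n) : 2.37 < triangleTerm n := by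
  have hn' : (16 : ℝ) ≤ n := by exact_mod_cast hn
  have h : 0.96 < Real.sqrt (((n : ℝ) - 4) / ((n : ℝ) - 3)) := by
    apply Real.lt_sqrt_of_sq_lt
    rw [lt_div_iff₀ (by linarith)]
    linarith
  have := lt_sqrt_two
  unfold triangleTerm
  linarith

theorem sqrt_two_eq : Real.sqrt 2 = Real.sqrt (1 / 2) + Real.sqrt (1 / 2) := by
  rw [← two_mul, show (2 : ℝ) = 2 ^ 2 * (1 / 2) by norm_num, Real.sqrt_mul (by norm_num),
    Real.sqrt_sq (by norm_num)]
  norm_num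

theorem edgeTerm_two_right {c : ℕ} (hc : 1 ≤ c) : edgeTerm 2 c = Real.sqrt (1 / 2) := by
  have : (0 : ℝ) < c := by exact_mod_cast hc
  unfold edgeTerm
  congr 1
  push_cast
  field_simp
  ring

theorem triangle_sum_eq {c n : ℕ} (hc : 1 ≤ c) (h : 1 + 2 + c = n) :
    edgeTerm 1 2 + edgeTerm 2 c + edgeTerm 1 c = triangleTerm n := by
  subst h
  rw [edgeTerm_comm 1 2, edgeTerm_two_right le_rfl, edgeTerm_two_right hc, edgeTerm_one_left,
    triangleTerm, sqrt_two_eq]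
  congr 3 <;> push_cast <;> ring

theorem edgeTerm_add_le_sqrt_two {b c : ℕ} (hb : 4 ≤ b) (hbc : b ≤ c) (h : 15 ≤ b + c) :
    edgeTerm 1 b + edgeTerm b c ≤ Real.sqrt 2 := by
  have hb0 : (4 : ℝ) ≤ b := by exact_mod_cast hb
  have hc0 : (b : ℝ) ≤ c := by exact_mod_cast hbc
  have h0 : (15 : ℝ) ≤ b + c := by exact_mod_cast h
  have key : 0 ≤ 6 * (b : ℝ) * c - 16 * c - 40 * b + 80 := by
    rcases (by omega : b = 4 ∨ b = 5 ∨ b = 6 ∨ b = 7 ∨ 8 ≤ b) with rfl | rfl | rfl | rfl | h8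
    · push_cast at *; linarith
    · push_cast at *; linarith
    · push_cast at *; linarith
    · push_cast at *; linarith
    · have h8' : (8 : ℝ) ≤ b := by exact_mod_cast h8
      nlinarith
  rw [edgeTerm_one_left]
  unfold edgeTerm
  set A : ℝ := ((b : ℝ) - 1) / b with hA
  set B : ℝ := ((b : ℝ) + c - 2) / (b * c) with hB
  have hA0 : 0 ≤ A := div_nonneg (by linarith) (by linarith)
  have hB0 : 0 ≤ B := div_nonneg (by linarith) (by nlinarith)
  have hAB : 24 * A + 40 * B ≤ 30 := by
    have hbpos : (0 : ℝ) < b := by linarith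
    have hcpos : (0 : ℝ) < c := by linarith
    have : 30 - (24 * A + 40 * B) = (6 * (b : ℝ) * c - 16 * c - 40 * b + 80) / (b * c) := by
      rw [hA, hB]
      field_simp
      ring
    have h2 : 0 ≤ (6 * (b : ℝ) * c - 16 * c - 40 * b + 80) / (b * c) := by positivity
    linarith
  apply Real.le_sqrt_of_sq_le
  have h1 := Real.sq_sqrt hA0
  have h2 := Real.sq_sqrt hB0
  nlinarith [sq_nonneg (3 * Real.sqrt A - 5 * Real.sqrt B)]

theorem sqrt_lt_of_lt_sq {x y : ℝ} (hy : 0 < y) (h : x < y ^ 2) : Real.sqrt x < y :=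
  (Real.sqrt_lt' hy).2 h

theorem edgeTerm_one_three_sum_lt {c : ℕ} (hc : 12 ≤ c) :
    edgeTerm 1 3 + edgeTerm 3 c + edgeTerm 1 c < triangleTerm (1 + 3 + c) := by
  have hT : triangleTerm (1 + 3 + c) = Real.sqrt 2 + edgeTerm 1 (c + 1) := by
    rw [triangleTerm, edgeTerm_one_left]
    congr 3 <;> push_cast <;> ring
  have hs : Real.sqrt (2 / 3) < 0.81650 := sqrt_lt_of_lt_sq (by norm_num) (by norm_num)
  have h2 : 1.414213 < Real.sqrt 2 := Real.lt_sqrt_of_sq_lt (by norm_num)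
  have h13 : edgeTerm 1 3 = Real.sqrt (2 / 3) := by
    rw [edgeTerm_one_left]
    norm_num
  rw [hT, h13]
  rcases (by omega : c = 12 ∨ c = 13 ∨ 14 ≤ c) with rfl | rfl | h14
  · have e1 : edgeTerm 3 12 < 0.600926 := sqrt_lt_of_lt_sq (by norm_num) (by norm_num)
    have e2 : edgeTerm 1 12 < 0.957428 := sqrt_lt_of_lt_sq (by norm_num) (by norm_num)
    have e3 : 0.960768 < edgeTerm 1 (12 + 1) := Real.lt_sqrt_of_sq_lt (by norm_num)
    linarith
  · have e1 : edgeTerm 3 13 < 0.5992 := sqrt_lt_of_lt_sq (by norm_num) (by norm_num)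
    have e2 : edgeTerm 1 13 < 0.9608 := sqrt_lt_of_lt_sq (by norm_num) (by norm_num)
    have e3 : 0.9636 < edgeTerm 1 (13 + 1) := Real.lt_sqrt_of_sq_lt (by norm_num)
    linarith
  · have h14' : (14 : ℝ) ≤ c := by exact_mod_cast h14
    have e1 : edgeTerm 3 c < 0.5977 := by
      apply sqrt_lt_of_lt_sq (by norm_num)
      push_cast
      rw [div_lt_iff₀ (by linarith)]
      linarith
    have e2 : edgeTerm 1 c < edgeTerm 1 (c + 1) := by
      rw [edgeTerm_one_left, edgeTerm_one_left]
      exact sqrt_sub_one_div_lt (by linarith) (by push_cast; linarith)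
    linarith

theorem triangle_sum_lt_of_le {a b c n : ℕ} (hn : 16 ≤ n) (ha : 1 ≤ a) (hab : a ≤ b) (hbc : b ≤ c)
    (h : a + b + c = n) (hne : ¬ (a = 1 ∧ b = 2)) :
    edgeTerm a b + edgeTerm b c + edgeTerm a c < triangleTerm n := by
  have hT := lt_triangleTerm hn
  have hhalf := sqrt_half_lt
  rcases (by omega : 2 ≤ a ∨ (a = 1 ∧ b = 1) ∨ (a = 1 ∧ b = 3) ∨ (a = 1 ∧ 4 ≤ b)) with
    ha2 | ⟨rfl, rfl⟩ | ⟨rfl, rfl⟩ | ⟨rfl, hb⟩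
  · have h1 := edgeTerm_le_sqrt_half ha2 (ha2.trans hab)
    have h2 := edgeTerm_le_sqrt_half (ha2.trans hab) ((ha2.trans hab).trans hbc)
    have h3 := edgeTerm_le_sqrt_half ha2 ((ha2.trans hab).trans hbc)
    linarith
  · have h1 : edgeTerm 1 1 = 0 := by
      rw [edgeTerm_one_left]
      norm_num
    have h2 : edgeTerm 1 c ≤ 1 := by
      have hc : (1 : ℝ) ≤ c := by exact_mod_cast hbc
      rw [edgeTerm_one_left, Real.sqrt_le_one, div_le_one (by linarith)]
      linarith
    linarith
  · subst h
    exact edgeTerm_one_three_sum_lt (by omega)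
  · have h1 := edgeTerm_add_le_sqrt_two hb hbc (by omega)
    have hbR : (4 : ℝ) ≤ b := by exact_mod_cast hb
    have hcR : (b : ℝ) ≤ c := by exact_mod_cast hbc
    have hT' : triangleTerm n = Real.sqrt 2 + edgeTerm 1 (b + c - 2) := by
      subst h
      rw [triangleTerm, edgeTerm_one_left]
      push_cast [show 2 ≤ b + c by omega]
      congr 3 <;> ring
    have h2 : edgeTerm 1 c < edgeTerm 1 (b + c - 2) := by
      rw [edgeTerm_one_left, edgeTerm_one_left]
      apply sqrt_sub_one_div_lt (by linarith)
      exact_mod_cast (by omega : c < b + c - 2)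
    linarith

theorem triangle_sum_le {a b c n : ℕ} (hn : 16 ≤ n) (ha : 1 ≤ a) (hb : 1 ≤ b) (hc : 1 ≤ c)
    (h : a + b + c = n) :
    edgeTerm a b + edgeTerm b c + edgeTerm a c ≤ triangleTerm n ∧
      (edgeTerm a b + edgeTerm b c + edgeTerm a c = triangleTerm n →
        (a = 1 ∨ b = 1 ∨ c = 1) ∧ (a = 2 ∨ b = 2 ∨ c = 2)) := by
  wlog hab : a ≤ b generalizing a b
  · have := this hb ha (by omega) (by omega)
    rw [edgeTerm_comm b a] at this
    constructor
    · linarith [this.1]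
    · intro hh
      have := this.2 (by linarith)
      omega
  wlog hbc : b ≤ c generalizing a b c
  · have hcb : c ≤ b := by omega
    by_cases hac : a ≤ c
    · have := this hb ha hc (by omega) hac hcb
      rw [edgeTerm_comm c b] at this
      constructor
      · linarith [this.1]
      · intro hh
        have := this.2 (by linarith)
        omega
    · have := this hb hc ha (by omega) (by omega) hab
      rw [edgeTerm_comm c a, edgeTerm_comm c b] at this
      constructor
      · linarith [this.1]
      · intro hh
        have := this.2 (by linarith)
        omega
  by_cases h12 : a = 1 ∧ b = 2
  · obtain ⟨rfl, rfl⟩ := h12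
    exact ⟨(triangle_sum_eq hc h).le, fun _ => by omega⟩
  · have := triangle_sum_lt_of_le hn ha hab hbc h h12
    exact ⟨this.le, fun hh => absurd hh this.ne⟩

namespace SimpleGraph

variable {V : Type*} {G : SimpleGraph V}

theorem Connected.of_adj_reachable {H : SimpleGraph V} (hG : G.Connected)
    (h : ∀ p q, G.Adj p q → H.Reachable p q) : H.Connected := by
  have := hG.nonempty
  refine ⟨fun p q => ?_⟩
  obtain ⟨w⟩ := hG.preconnected p q
  induction w with
  | nil => exact Reachable.refl _
  | cons hadj _ ih => exact (h _ _ hadj).trans ih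

theorem Connected.dist_le_dist_add_one (hG : G.Connected) {p q : V} (h : G.Adj p q) (w : V) :
    G.dist w q ≤ G.dist w p + 1 := by
  have := hG.dist_triangle (u := w) (v := p) (w := q)
  rwa [dist_eq_one_iff_adj.2 h] at this

theorem Connected.exists_adj_dist_add_one (hG : G.Connected) {w v : V} (h : w ≠ v) :
    ∃ v', G.Adj v' v ∧ G.dist w v' + 1 = G.dist w v := by
  obtain ⟨p, hp⟩ := hG.exists_walk_length_eq_dist v w
  cases p with
  | nil => exact absurd rfl h
  | @cons _ v' _ hadj p =>
    refine ⟨v', hadj.symm, ?_⟩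
    have h1 := dist_le p
    have h2 := hG.dist_le_dist_add_one hadj.symm w
    rw [Walk.length_cons, dist_comm] at hp
    rw [dist_comm] at h1
    omega

theorem Walk.exists_edges_eq_of_length_eq_three {u : V} (c : G.Walk u u) (hlen : c.length = 3) :
    ∃ x y, x ≠ y ∧ u ≠ x ∧ u ≠ y ∧ c.edges = [s(u, x), s(x, y), s(y, u)] := by
  match c, hlen with
  | .cons (v := x) h₁ (.cons (v := y) h₂ (.cons h₃ .nil)), _ =>
    exact ⟨x, y, h₂.ne, h₁.ne, h₃.ne.symm, rfl⟩

/-- Two cycles based at `u` that meet only in `u`, in a connected graph with one edge more than it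
has vertices. -/
structure IsCyclePairAt [Fintype V] (G : SimpleGraph V) {u : V} (c₁ c₂ : G.Walk u u) : Prop where
  connected : G.Connected
  ncard_edgeSet : G.edgeSet.ncard = Fintype.card V + 1
  isCycle_left : c₁.IsCycle
  isCycle_right : c₂.IsCycle
  eq_of_mem : ∀ v, v ∈ c₁.support → v ∈ c₂.support → v = u

variable [Fintype V]

theorem isAcyclic_of_ncard_edgeSet (hG : G.Connected)
    (h : G.edgeSet.ncard + 1 = Fintype.card V) : G.IsAcyclic := by
  refine (isTree_iff_connected_and_card.2 ⟨hG, ?_⟩).isAcyclic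
  rwa [Nat.card_coe_set_eq, Nat.card_eq_fintype_card]

theorem ncard_edgeSet_deleteEdges_pair {e₁ e₂ : Sym2 V} (h₁ : e₁ ∈ G.edgeSet)
    (h₂ : e₂ ∈ G.edgeSet) (hne : e₁ ≠ e₂) :
    (G.deleteEdges {e₁, e₂}).edgeSet.ncard + 2 = G.edgeSet.ncard := by
  rw [edgeSet_deleteEdges, ← Set.ncard_pair hne]
  exact Set.ncard_sdiff_add_ncard_of_subset (Set.insert_subset h₁ (Set.singleton_subset_iff.2 h₂))

namespace IsCyclePairAt

variable {u : V} {c₁ c₂ : G.Walk u u}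

theorem symm (h : G.IsCyclePairAt c₁ c₂) : G.IsCyclePairAt c₂ c₁ :=
  ⟨h.connected, h.ncard_edgeSet, h.isCycle_right, h.isCycle_left,
    fun v h₁ h₂ => h.eq_of_mem v h₂ h₁⟩

theorem notMem_edges_right (h : G.IsCyclePairAt c₁ c₂) {e : Sym2 V} (he : e ∈ c₁.edges) :
    e ∉ c₂.edges := by
  induction e with | h p q
  intro he'
  have hp := h.eq_of_mem p (c₁.fst_mem_support_of_mem_edges he)
    (c₂.fst_mem_support_of_mem_edges he')
  have hq := h.eq_of_mem q (c₁.snd_mem_support_of_mem_edges he)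
    (c₂.snd_mem_support_of_mem_edges he')
  exact (c₁.adj_of_mem_edges he).ne (hp.trans hq.symm)

theorem isAcyclic_deleteEdges (h : G.IsCyclePairAt c₁ c₂) {e₁ e₂ : Sym2 V} (h₁ : e₁ ∈ c₁.edges)
    (h₂ : e₂ ∈ c₂.edges) : (G.deleteEdges {e₁, e₂}).IsAcyclic := by
  have hne : e₁ ≠ e₂ := by
    rintro rfl
    exact h.notMem_edges_right h₁ h₂
  have hcard := ncard_edgeSet_deleteEdges_pair (c₁.edges_subset_edgeSet h₁)
    (c₂.edges_subset_edgeSet h₂) hne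
  refine isAcyclic_of_ncard_edgeSet ?_ (by have := h.ncard_edgeSet; omega)
  have hc : (G.deleteEdges {e₁}).Connected := by
    induction e₁ with | h p q
    exact h.connected.connected_delete_edge_of_not_isBridge
      fun hb => hb.notMem_edges_of_isCycle h.isCycle_left h₁
  have hmem : ∀ e ∈ c₂.edges, e ∈ (G.deleteEdges {e₁}).edgeSet := fun e he => by
    rw [edgeSet_deleteEdges]
    exact ⟨c₂.edges_subset_edgeSet he, fun hh => h.notMem_edges_right h₁ (hh ▸ he)⟩
  have hc' : ((G.deleteEdges {e₁}).deleteEdges {e₂}).Connected := by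
    induction e₂ with | h p q
    refine hc.connected_delete_edge_of_not_isBridge
      fun hb => hb.notMem_edges_of_isCycle (h.isCycle_right.transfer hmem) ?_
    rwa [Walk.edges_transfer]
  rwa [deleteEdges_deleteEdges, Set.singleton_union] at hc'

theorem not_adj_of_four_le (h : G.IsCyclePairAt c₁ c₂) (hlen : 4 ≤ c₁.length) {p q s : V}
    (hpq : s(p, q) ∈ c₁.edges) (hps : s(p, s) ∈ c₁.edges) (hsq : s ≠ q) : ¬ G.Adj s q := by
  classical
  intro hadj
  have hcard : ∀ (c : G.Walk u u), c.IsCycle → c.edges.toFinset.card = c.length := fun c hc => by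
    rw [List.toFinset_card_of_nodup hc.edges_nodup, Walk.length_edges]
  obtain ⟨e₁, he₁, hne₁⟩ := Finset.exists_mem_notMem_of_card_lt_card
    (s := {s(p, q), s(p, s), s(s, q)}) (t := c₁.edges.toFinset)
    (Finset.card_le_three.trans_lt (by rw [hcard _ h.isCycle_left]; omega))
  obtain ⟨e₂, he₂, hne₂⟩ := Finset.exists_mem_notMem_of_card_lt_card
    (s := {s(s, q)}) (t := c₂.edges.toFinset)
    (by
      rw [hcard _ h.isCycle_right, Finset.card_singleton]
      have := h.isCycle_right.three_le_length
      omega)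
  rw [List.mem_toFinset] at he₁ he₂
  simp only [Finset.mem_insert, Finset.mem_singleton, not_or] at hne₁ hne₂
  have hne : ∀ e ∈ c₁.edges, e ≠ e₂ := by
    rintro e he rfl
    exact h.notMem_edges_right he he₂
  have hT := h.isAcyclic_deleteEdges he₁ he₂
  have a₁ : (G.deleteEdges {e₁, e₂}).Adj p q := by
    rw [deleteEdges_adj]
    exact ⟨c₁.adj_of_mem_edges hpq, by simp [Ne.symm hne₁.1, hne _ hpq]⟩
  have a₂ : (G.deleteEdges {e₁, e₂}).Adj p s := by
    rw [deleteEdges_adj]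
    exact ⟨c₁.adj_of_mem_edges hps, by simp [Ne.symm hne₁.2.1, hne _ hps]⟩
  have a₃ : (G.deleteEdges {e₁, e₂}).Adj s q := by
    rw [deleteEdges_adj]
    exact ⟨hadj, by simp [Ne.symm hne₁.2.2, Ne.symm hne₂]⟩
  refine hT (.cons a₁ (.cons a₃.symm (.cons a₂.symm .nil))) ?_
  simp [Walk.cons_isCycle_iff, hsq.symm, a₁.ne, a₂.ne, a₁.ne.symm, a₂.ne.symm]

/-- In a triangle that is edge-disjoint from a cycle, no vertex has two nearest vertices. -/
theorem not_dist_eq (h : G.IsCyclePairAt c₁ c₂) {x y z : V} (hxy : s(x, y) ∈ c₁.edges)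
    (hxz : s(x, z) ∈ c₁.edges) (hyz : G.Adj y z) {w : V} (h₁ : G.dist w x = G.dist w y)
    (h₂ : G.dist w x ≤ G.dist w z) : False := by
  set H := G.deleteEdges {s(x, y), s(x, z)} with hH
  have hreach : ∀ k ≤ G.dist w x, ∀ v, G.dist w v = k → H.Reachable w v := by
    intro k
    induction k with
    | zero =>
      intro _ v hv
      rw [h.connected.dist_eq_zero_iff] at hv
      exact hv ▸ Reachable.refl _
    | succ k ih =>
      intro hk v hv
      have hne : w ≠ v := by
        rintro rfl
        simp at hv
      obtain ⟨v', hadj, hd⟩ := h.connected.exists_adj_dist_add_one hne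
      refine (ih (by omega) v' (by omega)).trans (Adj.reachable ?_)
      have hx : v' ≠ x := by rintro rfl; omega
      have hy : v' ≠ y := by rintro rfl; omega
      have hz : v' ≠ z := by rintro rfl; omega
      rw [hH, deleteEdges_adj]
      exact ⟨hadj, by simp [hx, hy, hz]⟩
  have hyz' : H.Adj y z := by
    rw [hH, deleteEdges_adj]
    have := c₁.adj_of_mem_edges hxy |>.ne
    have := c₁.adj_of_mem_edges hxz |>.ne
    exact ⟨hyz, by simp; grind⟩
  have hxy' : H.Reachable x y := (hreach _ le_rfl x rfl).symm.trans (hreach _ le_rfl y h₁.symm)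
  have hxz' : H.Reachable x z := hxy'.trans hyz'.reachable
  have hconn : H.Connected := by
    refine h.connected.of_adj_reachable fun p q hpq => ?_
    by_cases hmem : s(p, q) = s(x, y) ∨ s(p, q) = s(x, z)
    · simp only [Sym2.eq_iff] at hmem
      rcases hmem with (⟨rfl, rfl⟩ | ⟨rfl, rfl⟩) | (⟨rfl, rfl⟩ | ⟨rfl, rfl⟩)
      exacts [hxy', hxy'.symm, hxz', hxz'.symm]
    · exact Adj.reachable (deleteEdges_adj.2 ⟨hpq, hmem⟩)
  have hne : s(x, y) ≠ s(x, z) := by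
    have := hyz.ne
    have := c₁.adj_of_mem_edges hxz |>.ne
    simp only [ne_eq, Sym2.eq_iff]
    grind
  have hcard := ncard_edgeSet_deleteEdges_pair (c₁.edges_subset_edgeSet hxy)
    (c₁.edges_subset_edgeSet hxz) hne
  rw [← hH] at hcard
  have hT : H.IsAcyclic :=
    isAcyclic_of_ncard_edgeSet hconn (by have := h.ncard_edgeSet; omega)
  have hmem : ∀ e ∈ c₂.edges, e ∈ H.edgeSet := fun e he => by
    rw [hH, edgeSet_deleteEdges]
    refine ⟨c₂.edges_subset_edgeSet he, ?_⟩
    rintro (rfl | rfl)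
    exacts [h.notMem_edges_right hxy he, h.notMem_edges_right hxz he]
  exact hT _ (h.isCycle_right.transfer hmem)

end IsCyclePairAt

end SimpleGraph

section Side

variable {V : Type*} [Fintype V] {G : SimpleGraph V}

open Classical in
theorem sideCount_eq_card (G : SimpleGraph V) (p q : V) :
    sideCount G p q = (Finset.univ.filter fun w => G.dist w p < G.dist w q).card := by
  rw [sideCount, Nat.card_eq_fintype_card, Fintype.card_subtype]

theorem SimpleGraph.Connected.one_le_sideCount (hG : G.Connected) {p q : V} (h : p ≠ q) :
    1 ≤ sideCount G p q := by
  classical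
  rw [sideCount_eq_card, Nat.one_le_iff_ne_zero, Finset.card_ne_zero]
  exact ⟨p, by simpa using hG.pos_dist_of_ne h⟩

theorem sideCount_add_le (G : SimpleGraph V) (p q : V) :
    sideCount G p q + sideCount G q p ≤ Fintype.card V := by
  classical
  rw [sideCount_eq_card, sideCount_eq_card, ← Finset.card_union_of_disjoint]
  · exact Finset.card_le_univ _
  · rw [Finset.disjoint_filter]
    intro w _ h
    exact h.le.not_gt

theorem mem_of_sideCount_le {p q : V} {k : ℕ} (h : sideCount G p q ≤ k) {s : Finset V}
    (hs : s.card = k) (hmem : ∀ w ∈ s, G.dist w p < G.dist w q) (v : V)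
    (hv : G.dist v p < G.dist v q) : v ∈ s := by
  classical
  rw [sideCount_eq_card] at h
  rw [Finset.eq_of_subset_of_card_le (s := s) (fun w hw => by simpa using hmem w hw) (hs ▸ h)]
  simpa using hv

theorem card_le_sideCount {p q : V} {s : Finset V}
    (hmem : ∀ w ∈ s, G.dist w p < G.dist w q) : s.card ≤ sideCount G p q := by
  classical
  rw [sideCount_eq_card]
  exact Finset.card_le_card fun w hw => by simpa using hmem w hw

/-- The contribution of an unordered pair of vertices to the Graovac–Ghorbani index. -/
noncomputable def edgeValue (G : SimpleGraph V) : Sym2 V → ℝ :=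
  Sym2.lift ⟨fun p q => edgeTerm (sideCount G p q) (sideCount G q p), fun _ _ => edgeTerm_comm _ _⟩

theorem edgeValue_mk (G : SimpleGraph V) (p q : V) :
    edgeValue G s(p, q) = edgeTerm (sideCount G p q) (sideCount G q p) := rfl

open Classical in
theorem ABCGG_eq_sum (G : SimpleGraph V) : ABCGG G = ∑ e ∈ G.edgeFinset, edgeValue G e := by
  have h1 : ∑ d : G.Dart, edgeValue G d.edge = ∑ e ∈ G.edgeFinset, 2 * edgeValue G e := by
    rw [← Finset.sum_fiberwise_of_maps_to (t := G.edgeFinset) (g := SimpleGraph.Dart.edge)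
      (fun d _ => SimpleGraph.mem_edgeFinset.2 d.edge_mem)]
    refine Finset.sum_congr rfl fun e he => ?_
    rw [Finset.sum_congr rfl (g := fun _ => edgeValue G e)
      (fun d hd => by rw [(Finset.mem_filter.1 hd).2]), Finset.sum_const]
    have := G.dart_edge_fiber_card e (SimpleGraph.mem_edgeFinset.1 he)
    rw [nsmul_eq_mul]
    congr 1
    rw [← Nat.cast_two, ← this]
  have h2 : ∑ d : G.Dart, edgeValue G d.edge =
      ∑ x ∈ Finset.univ.filter (fun x : V × V => G.Adj x.1 x.2), edgeValue G s(x.1, x.2) :=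
    Finset.sum_bij (fun d _ => d.toProd) (fun d _ => by simp)
      (fun d _ d' _ h => SimpleGraph.Dart.ext _ _ h)
      (fun x hx => ⟨⟨x, (Finset.mem_filter.1 hx).2⟩, Finset.mem_univ _, rfl⟩)
      (fun d _ => rfl)
  rw [Finset.sum_filter, Fintype.sum_prod_type] at h2
  rw [← Finset.mul_sum, h2] at h1
  have h3 : ABCGG G = 1 / 2 * ∑ p : V, ∑ q : V, if G.Adj p q then edgeValue G s(p, q) else 0 := rfl
  rw [h3, h1]
  ring

namespace SimpleGraph.IsCyclePairAt

variable {u : V} {c₁ c₂ : G.Walk u u}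

theorem dist_lt_iff (h : G.IsCyclePairAt c₁ c₂) {x y z : V} (hxy : s(x, y) ∈ c₁.edges)
    (hxz : s(x, z) ∈ c₁.edges) (hyz : s(y, z) ∈ c₁.edges) (w : V) :
    G.dist w x < G.dist w y ↔ G.dist w x < G.dist w z := by
  have key : ∀ {y z : V}, s(x, y) ∈ c₁.edges → s(x, z) ∈ c₁.edges → s(y, z) ∈ c₁.edges →
      G.dist w x < G.dist w y → G.dist w x < G.dist w z := by
    intro y z hxy hxz hyz hlt
    by_contra hle
    rcases (not_lt.1 hle).eq_or_lt with heq | hlt'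
    · exact h.not_dist_eq hxz hxy (c₁.adj_of_mem_edges hyz).symm heq.symm hlt.le
    · have := h.connected.dist_le_dist_add_one (c₁.adj_of_mem_edges hyz).symm w
      omega
  exact ⟨key hxy hxz hyz, key hxz hxy (Sym2.eq_swap ▸ hyz)⟩

theorem sideCount_eq_sideCount (h : G.IsCyclePairAt c₁ c₂) {x y z : V} (hxy : s(x, y) ∈ c₁.edges)
    (hxz : s(x, z) ∈ c₁.edges) (hyz : s(y, z) ∈ c₁.edges) :
    sideCount G x y = sideCount G x z := by
  classical
  rw [sideCount_eq_card, sideCount_eq_card]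
  exact congrArg _ (Finset.filter_congr fun w _ => h.dist_lt_iff hxy hxz hyz w)

theorem sideCount_add_add (h : G.IsCyclePairAt c₁ c₂) {x y z : V} (hxy : s(x, y) ∈ c₁.edges)
    (hxz : s(x, z) ∈ c₁.edges) (hyz : s(y, z) ∈ c₁.edges) :
    sideCount G x y + sideCount G y z + sideCount G z x = Fintype.card V := by
  classical
  simp only [sideCount_eq_card, Finset.card_filter]
  rw [← Finset.sum_add_distrib, ← Finset.sum_add_distrib, ← Finset.card_univ,
    Finset.card_eq_sum_ones]
  refine Finset.sum_congr rfl fun w _ => ?_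
  have hyx : s(y, x) ∈ c₁.edges := Sym2.eq_swap ▸ hxy
  have hzx : s(z, x) ∈ c₁.edges := Sym2.eq_swap ▸ hxz
  have hzy : s(z, y) ∈ c₁.edges := Sym2.eq_swap ▸ hyz
  have e₁ := h.dist_lt_iff hxy hxz hyz w
  have e₂ := h.dist_lt_iff hyz hyx hzx w
  have e₃ := h.dist_lt_iff hzx hzy hxy w
  have n₁ : ¬ (G.dist w x = G.dist w y ∧ G.dist w x ≤ G.dist w z) :=
    fun hd => h.not_dist_eq hxy hxz (c₁.adj_of_mem_edges hyz) hd.1 hd.2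
  have n₂ : ¬ (G.dist w x = G.dist w z ∧ G.dist w x ≤ G.dist w y) :=
    fun hd => h.not_dist_eq hxz hxy (c₁.adj_of_mem_edges hyz).symm hd.1 hd.2
  have n₃ : ¬ (G.dist w y = G.dist w z ∧ G.dist w y ≤ G.dist w x) :=
    fun hd => h.not_dist_eq hyz hyx (c₁.adj_of_mem_edges hzx) hd.1 hd.2
  split_ifs <;> omega

/-- The contributions of the edges of a triangle, in terms of the sizes of its three sides. -/
theorem edgeValue_triangle (h : G.IsCyclePairAt c₁ c₂) {x y z : V} (hxy : s(x, y) ∈ c₁.edges)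
    (hxz : s(x, z) ∈ c₁.edges) (hyz : s(y, z) ∈ c₁.edges) :
    edgeValue G s(x, y) + edgeValue G s(y, z) + edgeValue G s(x, z) =
      edgeTerm (sideCount G x y) (sideCount G y z) +
      edgeTerm (sideCount G y z) (sideCount G z x) +
      edgeTerm (sideCount G x y) (sideCount G z x) := by
  have hyx : s(y, x) ∈ c₁.edges := Sym2.eq_swap ▸ hxy
  have hzx : s(z, x) ∈ c₁.edges := Sym2.eq_swap ▸ hxz
  have hzy : s(z, y) ∈ c₁.edges := Sym2.eq_swap ▸ hyz
  rw [edgeValue_mk, edgeValue_mk, edgeValue_mk, h.sideCount_eq_sideCount hyx hyz hxz,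
    h.sideCount_eq_sideCount hzy hzx hyx, h.sideCount_eq_sideCount hxz hxy hzy]

theorem two_le_sideCount (h : G.IsCyclePairAt c₁ c₂) (hlen : 4 ≤ c₁.length) {p q : V}
    (hpq : s(p, q) ∈ c₁.edges) : 2 ≤ sideCount G p q := by
  classical
  have h2 := h.isCycle_left.ncard_neighborSet_toSubgraph_eq_two
    (c₁.fst_mem_support_of_mem_edges hpq)
  obtain ⟨s, hs, hsq⟩ := Set.exists_ne_of_one_lt_ncard (h2 ▸ one_lt_two) q
  have hps : s(p, s) ∈ c₁.edges := by
    rwa [Subgraph.mem_neighborSet, ← Subgraph.mem_edgeSet, Walk.mem_edges_toSubgraph] at hs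
  have hadj := c₁.adj_of_mem_edges hps
  rw [← Finset.card_pair hadj.ne]
  refine card_le_sideCount fun w hw => ?_
  rcases Finset.mem_insert.1 hw with rfl | hw
  · simpa using h.connected.pos_dist_of_ne (c₁.adj_of_mem_edges hpq).ne
  · rw [Finset.mem_singleton.1 hw, dist_eq_one_iff_adj.2 hadj.symm]
    exact h.connected.one_lt_dist_of_ne_of_not_adj hsq (h.not_adj_of_four_le hlen hpq hps hsq)

end SimpleGraph.IsCyclePairAt

end Side

section Bound

variable {V : Type*} [Fintype V] {G : SimpleGraph V}

theorem SimpleGraph.Connected.edgeTerm_sideCount_le (hG : G.Connected) (hn : 16 ≤ Fintype.card V)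
    {e : Sym2 V} (he : e ∈ G.edgeSet) : edgeValue G e ≤ pendentTerm (Fintype.card V) := by
  induction e with | h p q
  rw [edgeValue_mk]
  exact edgeTerm_le_pendentTerm hn (hG.one_le_sideCount he.ne) (hG.one_le_sideCount he.ne')
    (sideCount_add_le G p q)

/-- If an edge attains the maximal contribution, then one of its ends is pendent. -/
theorem SimpleGraph.Connected.pendent_of_edgeValue_eq (hG : G.Connected)
    (hn : 16 ≤ Fintype.card V) {p q : V} (hpq : G.Adj p q)
    (h : edgeValue G s(p, q) = pendentTerm (Fintype.card V)) :
    (∀ r, G.Adj p r → r = q) ∨ (∀ r, G.Adj q r → r = p) := by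
  classical
  have key : ∀ {p q : V}, G.Adj p q → sideCount G p q = 1 →
      sideCount G q p = Fintype.card V - 1 → ∀ r, G.Adj p r → r = q := by
    intro p q hpq h₁ h₂ r hr
    by_contra hne
    have hd : G.dist r p = 1 := SimpleGraph.dist_eq_one_iff_adj.2 hr.symm
    have hle : ¬ G.dist r p < G.dist r q := by
      intro hlt
      have hmem := mem_of_sideCount_le h₁.le (s := {p}) (Finset.card_singleton p)
        (by simpa using hG.pos_dist_of_ne hpq.ne) r hlt
      exact hr.ne (Finset.mem_singleton.1 hmem).symm
    have hpos := hG.pos_dist_of_ne hne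
    have hsub : (Finset.univ.filter fun w => G.dist w q < G.dist w p) ⊆
        Finset.univ \ {p, r} := by
      intro w hw
      have hw' := (Finset.mem_filter.1 hw).2
      simp only [Finset.mem_sdiff, Finset.mem_univ, true_and, Finset.mem_insert,
        Finset.mem_singleton]
      rintro (rfl | rfl)
      · simp at hw'
      · omega
    have hcard := Finset.card_le_card hsub
    rw [← sideCount_eq_card, h₂, Finset.card_univ_sdiff, Finset.card_pair hr.ne] at hcard
    omega
  rw [edgeValue_mk] at h
  by_contra hcon
  refine (edgeTerm_lt_pendentTerm hn (hG.one_le_sideCount hpq.ne) (hG.one_le_sideCount hpq.ne')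
    (sideCount_add_le G p q) ?_).ne h
  rintro (⟨h₁, h₂⟩ | ⟨h₁, h₂⟩)
  · exact hcon (Or.inl (key hpq h₁ h₂))
  · exact hcon (Or.inr (key hpq.symm h₁ h₂))

theorem SimpleGraph.Connected.edgeValue_of_pendent (hG : G.Connected) {p q : V} (hpq : G.Adj p q)
    (h : ∀ r, G.Adj p r → r = q) : edgeValue G s(p, q) = pendentTerm (Fintype.card V) := by
  classical
  have h₁ := hG.one_le_sideCount hpq.ne
  have h₂ := sideCount_add_le G p q
  have h₃ : (Finset.univ.erase p).card ≤ sideCount G q p := by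
    refine card_le_sideCount fun w hw => ?_
    obtain ⟨v, hadj, hd⟩ := hG.exists_adj_dist_add_one (Finset.ne_of_mem_erase hw)
    rw [h v hadj.symm] at hd
    omega
  rw [Finset.card_erase_of_mem (Finset.mem_univ p), Finset.card_univ] at h₃
  rw [edgeValue_mk, show sideCount G p q = 1 by omega,
    show sideCount G q p = Fintype.card V - 1 by omega]
  exact edgeTerm_one_sub_one (by omega)

namespace SimpleGraph.IsCyclePairAt

variable {u : V} {c₁ c₂ : G.Walk u u}

theorem dist_lt_of_adj (h : G.IsCyclePairAt c₁ c₂) {x y z w : V} (hxy : s(x, y) ∈ c₁.edges)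
    (hxz : s(x, z) ∈ c₁.edges) (hyz : s(y, z) ∈ c₁.edges) (hw : G.Adj w x) (hy : w ≠ y)
    (hz : w ≠ z) : G.dist w x < G.dist w y := by
  have h₁ := dist_eq_one_iff_adj.2 hw
  have h₂ := h.connected.pos_dist_of_ne hy
  have h₃ := h.connected.pos_dist_of_ne hz
  by_contra hlt
  exact h.not_dist_eq hxy hxz (c₁.adj_of_mem_edges hyz) (w := w) (by omega) (by omega)

theorem three_le_sideCount (h : G.IsCyclePairAt c₁ c₂) {x y : V} (hux : s(u, x) ∈ c₁.edges)
    (huy : s(u, y) ∈ c₁.edges) (hxy : s(x, y) ∈ c₁.edges) : 3 ≤ sideCount G u x := by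
  classical
  have h2 := h.isCycle_right.ncard_neighborSet_toSubgraph_eq_two c₂.start_mem_support
  obtain ⟨p, q, hpq, hs⟩ := Set.ncard_eq_two.1 h2
  have hmem : ∀ v, v = p ∨ v = q → s(u, v) ∈ c₂.edges := fun v hv => by
    have : v ∈ c₂.toSubgraph.neighborSet u := by
      rw [hs]
      simpa using hv
    rwa [Subgraph.mem_neighborSet, ← Subgraph.mem_edgeSet, Walk.mem_edges_toSubgraph] at this
  have hadj : ∀ v, v = p ∨ v = q → G.Adj u v := fun v hv => c₂.adj_of_mem_edges (hmem v hv)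
  have hne : ∀ v, v = p ∨ v = q → ∀ s, s ∈ c₁.support → v ≠ s := by
    rintro v hv s hs rfl
    exact (hadj v hv).ne (h.eq_of_mem v hs (c₂.snd_mem_support_of_mem_edges (hmem v hv))).symm
  have hx := c₁.fst_mem_support_of_mem_edges hxy
  have hy := c₁.snd_mem_support_of_mem_edges hxy
  have hcard : ({u, p, q} : Finset V).card = 3 :=
    Finset.card_eq_three.2 ⟨u, p, q, (hadj p (.inl rfl)).ne, (hadj q (.inr rfl)).ne, hpq, rfl⟩
  rw [← hcard]
  refine card_le_sideCount fun w hw => ?_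
  rw [Finset.mem_insert, Finset.mem_insert, Finset.mem_singleton] at hw
  rcases hw with rfl | hw
  · simpa using h.connected.pos_dist_of_ne (c₁.adj_of_mem_edges hux).ne
  · exact h.dist_lt_of_adj hux huy hxy (hadj w hw).symm (hne w hw x hx) (hne w hw y hy)

open Classical in
theorem sum_edges_le (h : G.IsCyclePairAt c₁ c₂) (hn : 16 ≤ Fintype.card V) :
    ∑ e ∈ c₁.edges.toFinset, edgeValue G e ≤ triangleTerm (Fintype.card V) +
      ((c₁.length : ℝ) - 3) * pendentTerm (Fintype.card V) ∧
    (∑ e ∈ c₁.edges.toFinset, edgeValue G e = triangleTerm (Fintype.card V) +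
      ((c₁.length : ℝ) - 3) * pendentTerm (Fintype.card V) →
      ∃ x y, (∀ e, e ∈ c₁.edges ↔ e = s(u, x) ∨ e = s(x, y) ∨ e = s(u, y)) ∧
        sideCount G x u = 2 ∧ sideCount G y u = 1) := by
  rcases h.isCycle_left.three_le_length.eq_or_lt with h3 | h4
  · obtain ⟨x, y, hxy, hux, huy, hedges⟩ := c₁.exists_edges_eq_of_length_eq_three h3.symm
    have hmem : ∀ e, e ∈ c₁.edges ↔ e = s(u, x) ∨ e = s(x, y) ∨ e = s(u, y) := fun e => by
      rw [hedges, Sym2.eq_swap (a := y)]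
      simp
    have m₁ : s(u, x) ∈ c₁.edges := (hmem _).2 (.inl rfl)
    have m₂ : s(x, y) ∈ c₁.edges := (hmem _).2 (.inr (.inl rfl))
    have m₃ : s(u, y) ∈ c₁.edges := (hmem _).2 (.inr (.inr rfl))
    have hsum : ∑ e ∈ c₁.edges.toFinset, edgeValue G e =
        edgeValue G s(u, x) + edgeValue G s(x, y) + edgeValue G s(u, y) := by
      rw [List.sum_toFinset _ h.isCycle_left.edges_nodup, hedges, Sym2.eq_swap (a := y)]
      simp [add_assoc]
    rw [hsum, h.edgeValue_triangle m₁ m₃ m₂, ← h3]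
    have ht := triangle_sum_le hn (h.connected.one_le_sideCount hux)
      (h.connected.one_le_sideCount hxy) (h.connected.one_le_sideCount huy.symm)
      (h.sideCount_add_add m₁ m₃ m₂)
    have hthree := h.three_le_sideCount m₁ m₃ m₂
    have hx : sideCount G x y = sideCount G x u :=
      h.sideCount_eq_sideCount m₂ (Sym2.eq_swap ▸ m₁) (Sym2.eq_swap ▸ m₃)
    rw [Nat.cast_ofNat, sub_self, zero_mul, add_zero]
    refine ⟨ht.1, fun heq => ?_⟩
    have := ht.2 heq
    rw [hx] at this
    rcases (by omega : sideCount G x u = 2 ∧ sideCount G y u = 1 ∨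
      sideCount G y u = 2 ∧ sideCount G x u = 1) with h' | h'
    · exact ⟨x, y, hmem, h'⟩
    · refine ⟨y, x, fun e => ?_, h'⟩
      rw [hmem, Sym2.eq_swap (a := y), or_left_comm, or_comm (a := e = s(u, x)), or_left_comm]
  · have hlt : ∑ e ∈ c₁.edges.toFinset, edgeValue G e < triangleTerm (Fintype.card V) +
        ((c₁.length : ℝ) - 3) * pendentTerm (Fintype.card V) := by
      have hle : ∑ e ∈ c₁.edges.toFinset, edgeValue G e ≤
          c₁.edges.toFinset.card • Real.sqrt (1 / 2) := by
        refine Finset.sum_le_card_nsmul _ _ _ fun e he => ?_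
        rw [List.mem_toFinset] at he
        induction e with | h p q
        exact edgeTerm_le_sqrt_half (h.two_le_sideCount h4 he)
          (h.two_le_sideCount h4 (Sym2.eq_swap ▸ he))
      rw [List.toFinset_card_of_nodup h.isCycle_left.edges_nodup, Walk.length_edges,
        nsmul_eq_mul] at hle
      have h4' : (4 : ℝ) ≤ c₁.length := by exact_mod_cast h4
      have := lt_triangleTerm hn
      have := lt_pendentTerm hn
      have := sqrt_half_lt
      nlinarith
    exact ⟨hlt.le, fun heq => absurd heq hlt.ne⟩

open Classical in
theorem ABCGG_eq (h : G.IsCyclePairAt c₁ c₂) :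
    ABCGG G = ∑ e ∈ c₁.edges.toFinset, edgeValue G e + ∑ e ∈ c₂.edges.toFinset, edgeValue G e +
      ∑ e ∈ G.edgeFinset \ (c₁.edges.toFinset ∪ c₂.edges.toFinset), edgeValue G e ∧
    (G.edgeFinset \ (c₁.edges.toFinset ∪ c₂.edges.toFinset)).card + c₁.length + c₂.length =
      Fintype.card V + 1 := by
  have hdisj : Disjoint c₁.edges.toFinset c₂.edges.toFinset :=
    Finset.disjoint_left.2 fun e h₁ h₂ =>
      h.notMem_edges_right (List.mem_toFinset.1 h₁) (List.mem_toFinset.1 h₂)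
  have hsub : c₁.edges.toFinset ∪ c₂.edges.toFinset ⊆ G.edgeFinset := fun e he => by
    rw [Finset.mem_union, List.mem_toFinset, List.mem_toFinset] at he
    exact mem_edgeFinset.2 (he.elim (c₁.edges_subset_edgeSet ·) (c₂.edges_subset_edgeSet ·))
  constructor
  · rw [ABCGG_eq_sum, ← Finset.sum_union hdisj, add_comm, Finset.sum_sdiff hsub]
  · have hcard := Finset.card_sdiff_add_card_eq_card hsub
    rw [Finset.card_union_of_disjoint hdisj,
      List.toFinset_card_of_nodup h.isCycle_left.edges_nodup,
      List.toFinset_card_of_nodup h.isCycle_right.edges_nodup, Walk.length_edges,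
      Walk.length_edges] at hcard
    have := h.ncard_edgeSet
    rw [← coe_edgeFinset, Set.ncard_coe_finset] at this
    omega

theorem ABCGG_le (h : G.IsCyclePairAt c₁ c₂) (hn : 16 ≤ Fintype.card V) :
    ABCGG G ≤ 2 * triangleTerm (Fintype.card V) +
      ((Fintype.card V : ℝ) - 5) * pendentTerm (Fintype.card V) ∧
    (ABCGG G = 2 * triangleTerm (Fintype.card V) +
      ((Fintype.card V : ℝ) - 5) * pendentTerm (Fintype.card V) →
      (∃ x y, (∀ e, e ∈ c₁.edges ↔ e = s(u, x) ∨ e = s(x, y) ∨ e = s(u, y)) ∧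
        sideCount G x u = 2 ∧ sideCount G y u = 1) ∧
      (∃ a b, (∀ e, e ∈ c₂.edges ↔ e = s(u, a) ∨ e = s(a, b) ∨ e = s(u, b)) ∧
        sideCount G a u = 2 ∧ sideCount G b u = 1) ∧
      ∀ p q, G.Adj p q → s(p, q) ∉ c₁.edges → s(p, q) ∉ c₂.edges →
        (∀ r, G.Adj p r → r = q) ∨ (∀ r, G.Adj q r → r = p)) := by
  classical
  obtain ⟨hsum, hcard⟩ := h.ABCGG_eq
  set R := G.edgeFinset \ (c₁.edges.toFinset ∪ c₂.edges.toFinset) with hR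
  obtain ⟨b₁, e₁⟩ := h.sum_edges_le hn
  obtain ⟨b₂, e₂⟩ := h.symm.sum_edges_le hn
  have hle : ∀ e ∈ R, edgeValue G e ≤ pendentTerm (Fintype.card V) := fun e he =>
    h.connected.edgeTerm_sideCount_le hn (mem_edgeFinset.1 (Finset.mem_sdiff.1 he).1)
  have b₃ := Finset.sum_le_sum hle
  have hconst : ∑ _e ∈ R, pendentTerm (Fintype.card V) =
      ((Fintype.card V : ℝ) + 1 - c₁.length - c₂.length) * pendentTerm (Fintype.card V) := by
    rw [Finset.sum_const, nsmul_eq_mul]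
    congr 1
    have : ((R.card + c₁.length + c₂.length : ℕ) : ℝ) = (Fintype.card V + 1 : ℕ) := by rw [hcard]
    push_cast at this
    linarith
  rw [hsum]
  refine ⟨by linarith, fun heq => ⟨e₁ (by linarith), e₂ (by linarith), fun p q hpq n₁ n₂ => ?_⟩⟩
  have hall := (Finset.sum_eq_sum_iff_of_le hle).1 (by linarith)
  refine h.connected.pendent_of_edgeValue_eq hn hpq (hall _ ?_)
  simp [hR, hpq, n₁, n₂]

end SimpleGraph.IsCyclePairAt

end Bound

section Extremal

variable {V : Type*} {G : SimpleGraph V}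

/-- The oriented edges of two triangles `u x y` and `u a b` in which `x` and `a` carry the
pendent vertices `x'` and `a'`, and all other vertices are pendent at `u`. -/
def extremalRel (u x y x' a b a' p q : V) : Prop :=
  (p = u ∧ q = x) ∨ (p = x ∧ q = y) ∨ (p = y ∧ q = u) ∨
  (p = u ∧ q = a) ∨ (p = a ∧ q = b) ∨ (p = b ∧ q = u) ∨
  (p = x ∧ q = x') ∨ (p = a ∧ q = a') ∨ (p = u ∧ q ∉ [u, x, y, x', a, b, a'])

/-- A labelling of a graph exhibiting it as `S33 1 0 1 0 m`. -/
structure SimpleGraph.IsExtremalLabelling (G : SimpleGraph V) (u x y x' a b a' : V) : Prop where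
  nodup : [u, x, y, x', a, b, a'].Nodup
  adj_iff (p q : V) :
    G.Adj p q ↔ extremalRel u x y x' a b a' p q ∨ extremalRel u x y x' a b a' q p

variable {u x y x' a b a' : V}

theorem SimpleGraph.Connected.exists_of_sideCount_eq_two [Fintype V] (hG : G.Connected)
    (hxu : x ≠ u) (h : sideCount G x u = 2) :
    ∃ x', G.Adj x x' ∧ ¬ G.Adj u x' ∧ u ≠ x' ∧
      ∀ w, G.dist w x < G.dist w u → w = x ∨ w = x' := by
  classical
  have hx := hG.pos_dist_of_ne hxu
  rw [sideCount_eq_card] at h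
  obtain ⟨x', hx', hne⟩ := Finset.exists_mem_ne (h ▸ one_lt_two) x
  have hlt := (Finset.mem_filter.1 hx').2
  have hall : ∀ w, G.dist w x < G.dist w u → w = x ∨ w = x' := by
    have heq := Finset.eq_of_subset_of_card_le (s := {x, x'})
      (t := Finset.univ.filter fun w => G.dist w x < G.dist w u)
      (by
        intro w hw
        rcases Finset.mem_insert.1 hw with rfl | hw
        · simpa using hx
        · rwa [Finset.mem_singleton.1 hw])
      (by rw [h, Finset.card_pair hne.symm])
    intro w hw
    have hw' : w ∈ ({x, x'} : Finset V) := by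
      rw [heq]
      simpa using hw
    simpa using hw'
  obtain ⟨v, hv, hd⟩ := hG.exists_adj_dist_add_one hne.symm
  have h₁ := hG.dist_le_dist_add_one hv u
  have hvx : v = x := by
    refine (hall v ?_).resolve_right hv.ne
    rw [dist_comm (u := v) (v := x), dist_comm (u := v) (v := u)]
    rw [dist_comm (u := x') (v := x), dist_comm (u := x') (v := u)] at hlt
    omega
  subst hvx
  have h₂ := dist_eq_one_iff_adj.2 hv.symm
  refine ⟨x', hv, fun hadj => ?_, ?_, hall⟩
  · have := dist_eq_one_iff_adj.2 hadj.symm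
    omega
  · rintro rfl
    simp at hlt

theorem extremalRel_or_of_mem_left {p q : V} (hp : p ∈ [u, x, y]) (hq : q ∈ [u, x, y])
    (hne : p ≠ q) :
    extremalRel u x y x' a b a' p q ∨ extremalRel u x y x' a b a' q p := by
  simp only [List.mem_cons, List.not_mem_nil, or_false] at hp hq
  unfold extremalRel
  rcases hp with rfl | rfl | rfl <;> rcases hq with rfl | rfl | rfl <;> simp_all

theorem extremalRel_or_of_mem_right {p q : V} (hp : p ∈ [u, a, b]) (hq : q ∈ [u, a, b])
    (hne : p ≠ q) :
    extremalRel u x y x' a b a' p q ∨ extremalRel u x y x' a b a' q p := by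
  simp only [List.mem_cons, List.not_mem_nil, or_false] at hp hq
  unfold extremalRel
  rcases hp with rfl | rfl | rfl <;> rcases hq with rfl | rfl | rfl <;> simp_all

theorem SimpleGraph.Connected.isExtremalLabelling_of_sideCount [Fintype V] (hG : G.Connected)
    (hux : G.Adj u x) (hxy : G.Adj x y) (huy : G.Adj u y)
    (hua : G.Adj u a) (hab : G.Adj a b) (hub : G.Adj u b)
    (hxa : x ≠ a) (hxb : x ≠ b) (hya : y ≠ a) (hyb : y ≠ b)
    (hx : sideCount G x u = 2) (hy : sideCount G y u = 1)
    (ha : sideCount G a u = 2) (hb : sideCount G b u = 1)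
    (hleaf : ∀ p q, G.Adj p q → (p ∈ [u, x, y] ∧ q ∈ [u, x, y]) ∨ (p ∈ [u, a, b] ∧ q ∈ [u, a, b]) ∨
      (∀ r, G.Adj p r → r = q) ∨ (∀ r, G.Adj q r → r = p)) :
    ∃ x' a', G.IsExtremalLabelling u x y x' a b a' := by
  obtain ⟨x', hxx', hux', hux'_ne, hxs⟩ := hG.exists_of_sideCount_eq_two hux.ne' hx
  obtain ⟨a', haa', hua', hua'_ne, has⟩ := hG.exists_of_sideCount_eq_two hua.ne' ha
  have hside : ∀ {z}, G.Adj u z → sideCount G z u = 1 → ∀ w, G.dist w z < G.dist w u → w = z :=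
    fun {z} hz h w hw => Finset.mem_singleton.1 <|
      mem_of_sideCount_le h.le (Finset.card_singleton z)
        (by simpa using hG.pos_dist_of_ne hz.ne') w hw
  have hys := hside huy hy
  have hbs := hside hub hb
  have hx'a' : x' ≠ a' := by
    rintro rfl
    rcases hleaf x x' hxx' with h | h | h | h
    · simp only [List.mem_cons, List.not_mem_nil, or_false] at h
      rcases h.2 with h | h | h
      · exact hux'_ne h.symm
      · exact hxx'.ne h.symm
      · exact hux' (h ▸ huy)
    · simp only [List.mem_cons, List.not_mem_nil, or_false] at h
      rcases h.1 with h | h | h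
      · exact hux.ne h.symm
      · exact hxa h
      · exact hxb h
    · exact hux'_ne (h u hux.symm)
    · exact hxa (h a haa'.symm).symm
  have hnodup : [u, x, y, x', a, b, a'].Nodup := by
    simp only [List.nodup_cons, List.mem_cons, List.not_mem_nil, or_false, not_or,
      not_false_eq_true, List.nodup_nil, and_true]
    refine ⟨⟨hux.ne, huy.ne, hux'_ne, hua.ne, hub.ne, hua'_ne⟩,
      ⟨hxy.ne, hxx'.ne, hxa, hxb, ?_⟩, ⟨?_, hya, hyb, ?_⟩, ⟨?_, ?_, hx'a'⟩, ⟨hab.ne, haa'.ne⟩, ?_⟩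
    all_goals rintro rfl; contradiction
  have hrest : ∀ w, w ∉ [u, x, y, x', a, b, a'] → G.Adj u w := by
    intro w hw
    simp only [List.mem_cons, List.not_mem_nil, or_false, not_or] at hw
    obtain ⟨wu, wx, wy, wx', wa, wb, wa'⟩ := hw
    obtain ⟨v, hv, hd⟩ := hG.exists_adj_dist_add_one wu
    have hlt : G.dist w v < G.dist w u := by omega
    have hvx : v ≠ x := by rintro rfl; exact (hxs w hlt).elim wx wx'
    have hvy : v ≠ y := by rintro rfl; exact wy (hys w hlt)
    have hva : v ≠ a := by rintro rfl; exact (has w hlt).elim wa wa'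
    have hvb : v ≠ b := by rintro rfl; exact wb (hbs w hlt)
    have hleaf_v : ∀ r, G.Adj v r → r = u := by
      rcases hleaf v u hv with h | h | h | h
      · simp [hv.ne, hvx, hvy] at h
      · simp [hv.ne, hva, hvb] at h
      · exact h
      · exact absurd (h x hux).symm hvx
    by_cases hwv : w = v
    · exact hwv ▸ hv.symm
    · obtain ⟨v', hv', hd'⟩ := hG.exists_adj_dist_add_one hwv
      rw [hleaf_v v' hv'.symm] at hd'
      omega
  have hrel : ∀ p q, G.Adj p q → (∀ r, G.Adj p r → r = q) →
      extremalRel u x y x' a b a' q p := by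
    intro p q hpq hp
    have hno : ∀ {v r s : V}, G.Adj v r → G.Adj v s → r ≠ s → p ≠ v := by
      rintro v r s hr hs hrs rfl
      exact hrs ((hp r hr).trans (hp s hs).symm)
    have pu := hno hux huy hxy.ne
    have px := hno hxy hux.symm huy.ne'
    have py := hno hxy.symm huy.symm hux.ne'
    have pa := hno hab hua.symm hub.ne'
    have pb := hno hab.symm hub.symm hua.ne'
    unfold extremalRel
    by_cases px' : p = x'
    · subst px'
      simp [hp x hxx'.symm]
    by_cases pa' : p = a'
    · subst pa'
      simp [hp a haa'.symm]
    have hmem : p ∉ [u, x, y, x', a, b, a'] := by simp [pu, px, py, px', pa, pb, pa']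
    have hq := (hp u (hrest p hmem).symm).symm
    tauto
  have hadj : ∀ p q, extremalRel u x y x' a b a' p q → G.Adj p q := by
    rintro p q (⟨rfl, rfl⟩ | ⟨rfl, rfl⟩ | ⟨rfl, rfl⟩ | ⟨rfl, rfl⟩ | ⟨rfl, rfl⟩ | ⟨rfl, rfl⟩ |
      ⟨rfl, rfl⟩ | ⟨rfl, rfl⟩ | ⟨rfl, h⟩)
    exacts [hux, hxy, huy.symm, hua, hab, hub.symm, hxx', haa', hrest q h]
  refine ⟨x', a', hnodup, fun p q => ⟨fun h => ?_,
    fun h => h.elim (hadj p q) fun h => (hadj q p h).symm⟩⟩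
  rcases hleaf p q h with ⟨hp, hq⟩ | ⟨hp, hq⟩ | hp | hq
  · exact extremalRel_or_of_mem_left hp hq h.ne
  · exact extremalRel_or_of_mem_right hp hq h.ne
  · exact .inr (hrel p q h hp)
  · exact .inl (hrel q p h.symm hq)

end Extremal

section Labelling

variable {V W : Type*} {G : SimpleGraph V} {H : SimpleGraph W} {u x y x' a b a' : V}

theorem extremalRel.ne {p q : V} (h : extremalRel u x y x' a b a' p q)
    (hnodup : [u, x, y, x', a, b, a'].Nodup) : p ≠ q := by
  simp only [List.nodup_cons, List.mem_cons, List.not_mem_nil, or_false, not_or] at hnodup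
  rintro rfl
  rcases h with ⟨rfl, h⟩ | ⟨rfl, h⟩ | ⟨rfl, h⟩ | ⟨rfl, h⟩ | ⟨rfl, h⟩ | ⟨rfl, h⟩ | ⟨rfl, h⟩ |
    ⟨rfl, h⟩ | ⟨rfl, h⟩
  all_goals simp_all

theorem extremalRel_map_iff (e : V ≃ W) {p q : V} :
    extremalRel (e u) (e x) (e y) (e x') (e a) (e b) (e a') (e p) (e q) ↔
      extremalRel u x y x' a b a' p q := by
  simp [extremalRel]

theorem List.Nodup.exists_equiv_map_eq [Finite V] {l : List V} {l' : List W} (e : V ≃ W)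
    (hl : l.Nodup) (hl' : l'.Nodup) (hlen : l.length = l'.length) :
    ∃ f : V ≃ W, l.map f = l' := by
  have := Equiv.Perm.isMultiplyPretransitive W l.length
  obtain ⟨σ, hσ⟩ := MulAction.exists_smul_eq (Equiv.Perm W)
    ((⟨l.get, List.nodup_iff_injective_get.1 hl⟩ : Fin l.length ↪ V).trans e.toEmbedding)
    (⟨l'.get ∘ Fin.cast hlen,
      (List.nodup_iff_injective_get.1 hl').comp (Fin.cast_injective hlen)⟩ : Fin l.length ↪ W)
  refine ⟨e.trans σ, List.ext_get (by simpa using hlen) fun i h₁ h₂ => ?_⟩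
  simpa using DFunLike.congr_fun hσ ⟨i, by simpa using h₁⟩

namespace SimpleGraph.IsExtremalLabelling

theorem map (h : G.IsExtremalLabelling u x y x' a b a') (f : G ≃g H) :
    H.IsExtremalLabelling (f u) (f x) (f y) (f x') (f a) (f b) (f a') := by
  refine ⟨h.nodup.map f.injective, fun p q => ?_⟩
  obtain ⟨p, rfl⟩ := f.surjective p
  obtain ⟨q, rfl⟩ := f.surjective q
  rw [f.map_adj_iff, h.adj_iff]
  exact or_congr (extremalRel_map_iff f.toEquiv).symm (extremalRel_map_iff f.toEquiv).symm

theorem nonempty_iso [Finite V] {u₂ x₂ y₂ x₂' a₂ b₂ a₂' : W} (e : V ≃ W)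
    (h : G.IsExtremalLabelling u x y x' a b a')
    (h₂ : H.IsExtremalLabelling u₂ x₂ y₂ x₂' a₂ b₂ a₂') : Nonempty (G ≃g H) := by
  obtain ⟨f, hf⟩ := h.nodup.exists_equiv_map_eq e h₂.nodup rfl
  simp only [List.map_cons, List.map_nil, List.cons.injEq, and_true] at hf
  obtain ⟨rfl, rfl, rfl, rfl, rfl, rfl, rfl⟩ := hf
  refine ⟨⟨f, fun {p q} => ?_⟩⟩
  rw [h.adj_iff, h₂.adj_iff, extremalRel_map_iff, extremalRel_map_iff]

theorem s33 (m : ℕ) : (S33 1 0 1 0 m).IsExtremalLabelling (.inl 0) (.inl 1) (.inl 2)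
    (.inr (.inl 0)) (.inl 3) (.inl 4) (.inr (.inr (.inr (.inl 0)))) := by
  refine ⟨by simp, fun p q => ?_⟩
  have key : ∀ p q : SVert 1 0 1 0 m,
      (p = Sum.inl 0 ∧ q = Sum.inl 1) ∨
      (p = Sum.inl 1 ∧ q = Sum.inl 2) ∨
      (p = Sum.inl 2 ∧ q = Sum.inl 0) ∨
      (p = Sum.inl 0 ∧ q = Sum.inl 3) ∨
      (p = Sum.inl 3 ∧ q = Sum.inl 4) ∨
      (p = Sum.inl 4 ∧ q = Sum.inl 0) ∨
      (∃ i : Fin 1, p = Sum.inl 1 ∧ q = Sum.inr (Sum.inl i)) ∨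
      (∃ i : Fin 0, p = Sum.inl 2 ∧ q = Sum.inr (Sum.inr (Sum.inl i))) ∨
      (∃ i : Fin 1, p = Sum.inl 3 ∧ q = Sum.inr (Sum.inr (Sum.inr (Sum.inl i)))) ∨
      (∃ i : Fin 0, p = Sum.inl 4 ∧ q = Sum.inr (Sum.inr (Sum.inr (Sum.inr (Sum.inl i))))) ∨
      (∃ i : Fin m, p = Sum.inl 0 ∧ q = Sum.inr (Sum.inr (Sum.inr (Sum.inr (Sum.inr i))))) ↔
      extremalRel (.inl 0) (.inl 1) (.inl 2) (.inr (.inl 0)) (.inl 3) (.inl 4)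
        (.inr (.inr (.inr (.inl 0)))) p q := by
    intro p q
    have hq : q ∉ [(.inl 0 : SVert 1 0 1 0 m), .inl 1, .inl 2, .inr (.inl 0), .inl 3, .inl 4,
        .inr (.inr (.inr (.inl 0)))] ↔
        ∃ i : Fin m, q = Sum.inr (Sum.inr (Sum.inr (Sum.inr (Sum.inr i)))) := by
      rcases q with q | q | q | q | q | q
      · fin_cases q <;> simp
      · simp [Subsingleton.elim q 0]
      · exact q.elim0
      · simp [Subsingleton.elim q 0]
      · exact q.elim0
      · simp
    unfold extremalRel
    rw [hq]
    simp
  rw [S33, SimpleGraph.fromRel_adj, key, key]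
  exact and_iff_right_of_imp fun h => h.elim (·.ne (by simp)) fun h => (h.ne (by simp)).symm

theorem symm (h : G.IsExtremalLabelling u x y x' a b a') :
    G.IsExtremalLabelling u a b a' x y x' := by
  have hperm : [u, a, b, a', x, y, x'].Perm [u, x, y, x', a, b, a'] :=
    (List.perm_append_comm (l₁ := [a, b, a']) (l₂ := [x, y, x'])).cons u
  have hrel (p q : V) : extremalRel u a b a' x y x' p q = extremalRel u x y x' a b a' p q := by
    unfold extremalRel
    rw [hperm.mem_iff]
    ac_rfl
  exact ⟨hperm.nodup_iff.2 h.nodup, fun p q => by rw [h.adj_iff, hrel, hrel]⟩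

theorem eq_of_adj_left (h : G.IsExtremalLabelling u x y x' a b a') {p : V} (hp : G.Adj x' p) :
    p = x := by
  have hnodup := h.nodup
  simp only [List.nodup_cons, List.mem_cons, List.not_mem_nil, or_false, not_or] at hnodup
  rw [h.adj_iff] at hp
  simpa [extremalRel, hnodup, eq_comm (a := x')] using hp

theorem eq_of_adj (h : G.IsExtremalLabelling u x y x' a b a') {p q : V}
    (hp : p ∉ [u, x, y, x', a, b, a']) (hpq : G.Adj p q) : q = u := by
  rw [h.adj_iff] at hpq
  simp only [List.mem_cons, List.not_mem_nil, or_false, not_or] at hp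
  simp only [extremalRel, hp, false_and, and_false, false_or, or_false] at hpq
  exact hpq.1

theorem adj_of_notMem (h : G.IsExtremalLabelling u x y x' a b a') {p : V}
    (hp : p ∉ [u, x, y, x', a, b, a']) : G.Adj u p :=
  (h.adj_iff u p).2 (by simp only [extremalRel, hp]; simp)

theorem adj_triangle (h : G.IsExtremalLabelling u x y x' a b a') :
    G.Adj u x ∧ G.Adj x y ∧ G.Adj u y ∧ G.Adj x x' := by
  simp [h.adj_iff, extremalRel]

end SimpleGraph.IsExtremalLabelling

end Labelling

section Converse

variable {V : Type*} [Fintype V] {G : SimpleGraph V} {u x y x' a b a' : V} {c₁ c₂ : G.Walk u u}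

namespace SimpleGraph.IsExtremalLabelling

theorem edgeValue_add_add (h : G.IsExtremalLabelling u x y x' a b a') (hc : G.IsCyclePairAt c₁ c₂)
    (hux : s(u, x) ∈ c₁.edges) (hxy : s(x, y) ∈ c₁.edges) (huy : s(u, y) ∈ c₁.edges) :
    edgeValue G s(u, x) + edgeValue G s(x, y) + edgeValue G s(u, y) =
      triangleTerm (Fintype.card V) := by
  classical
  have hxu : s(x, u) ∈ c₁.edges := Sym2.eq_swap ▸ hux
  have hsum := hc.sideCount_add_add hux huy hxy
  have hnodup := h.nodup
  simp only [List.nodup_cons, List.mem_cons, List.not_mem_nil, or_false, not_or] at hnodup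
  have hx'y : x' ≠ y := Ne.symm hnodup.2.2.1.1
  have hx'u : x' ≠ u := Ne.symm hnodup.1.2.2.1
  have ha'u : a' ≠ u := Ne.symm hnodup.1.2.2.2.2.2
  have ha'x : a' ≠ x := Ne.symm hnodup.2.1.2.2.2.2
  have ha'y : a' ≠ y := Ne.symm hnodup.2.2.1.2.2.2
  have hxa : x ≠ a := hnodup.2.1.2.2.1
  have hya : y ≠ a := hnodup.2.2.1.2.1
  have h₁ : 1 ≤ sideCount G y u :=
    hc.connected.one_le_sideCount (c₁.adj_of_mem_edges huy).ne'
  have h₂ : 2 ≤ sideCount G x y := by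
    rw [← Finset.card_pair h.adj_triangle.2.2.2.ne]
    refine card_le_sideCount fun w hw => ?_
    rcases Finset.mem_insert.1 hw with rfl | hw
    · simpa using hc.connected.pos_dist_of_ne (c₁.adj_of_mem_edges hxy).ne
    · rw [Finset.mem_singleton.1 hw]
      exact hc.dist_lt_of_adj hxy hxu (Sym2.eq_swap ▸ huy) h.adj_triangle.2.2.2.symm hx'y hx'u
  have h₃ : Fintype.card V ≤ sideCount G u x + 3 := by
    have hle : (Finset.univ \ {x, y, x'}).card ≤ sideCount G u x := by
      refine card_le_sideCount fun w hw => ?_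
      simp only [Finset.mem_sdiff, Finset.mem_univ, Finset.mem_insert, Finset.mem_singleton,
        true_and, not_or] at hw
      obtain ⟨wx, wy, wx'⟩ := hw
      by_cases wu : w = u
      · subst wu
        simpa using hc.connected.pos_dist_of_ne wx
      by_cases wa' : w = a'
      · subst wa'
        have d₁ := hc.connected.dist_le_dist_add_one h.symm.adj_triangle.1.symm w
        have d₂ := dist_eq_one_iff_adj.2 h.symm.adj_triangle.2.2.2.symm
        have d₃ := hc.connected.one_lt_dist_of_ne_of_not_adj ha'x
          fun hadj => hxa (h.symm.eq_of_adj_left hadj)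
        have d₄ := hc.connected.one_lt_dist_of_ne_of_not_adj ha'y
          fun hadj => hya (h.symm.eq_of_adj_left hadj)
        by_contra hlt
        exact hc.not_dist_eq hux huy h.adj_triangle.2.1 (w := w) (by omega) (by omega)
      · refine hc.dist_lt_of_adj hux huy hxy (SimpleGraph.Adj.symm ?_) wx wy
        by_cases wa : w = a
        · exact wa ▸ h.symm.adj_triangle.1
        by_cases wb : w = b
        · exact wb ▸ h.symm.adj_triangle.2.2.1
        exact h.adj_of_notMem (by simp [wu, wx, wy, wx', wa, wb, wa'])
    rw [Finset.card_univ_sdiff] at hle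
    have := Finset.card_le_three (a := x) (b := y) (c := x')
    omega
  have h₄ := hc.three_le_sideCount hux huy hxy
  rw [hc.edgeValue_triangle hux huy hxy, show sideCount G x y = 2 by omega,
    show sideCount G y u = 1 by omega,
    ← triangle_sum_eq (c := sideCount G u x) (n := Fintype.card V) (by omega) (by omega),
    edgeTerm_comm 2 1, edgeTerm_comm _ 2, edgeTerm_comm _ 1]
  ring

theorem ABCGG_eq (h : G.IsExtremalLabelling u x y x' a b a') (hG : G.Connected)
    (hcard : G.edgeSet.ncard = Fintype.card V + 1) :
    ABCGG G = 2 * triangleTerm (Fintype.card V) +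
      ((Fintype.card V : ℝ) - 5) * pendentTerm (Fintype.card V) := by
  classical
  have hnodup := h.nodup
  simp only [List.nodup_cons, List.mem_cons, List.not_mem_nil, or_false, not_or] at hnodup
  have key : ∀ {x y x' a b a' : V}, G.IsExtremalLabelling u x y x' a b a' →
      ∃ c : G.Walk u u, c.IsCycle ∧ c.support = [u, x, y, u] ∧
        c.edges = [s(u, x), s(x, y), s(u, y)] := by
    intro x y x' a b a' h
    have h₁ := h.adj_triangle.1
    have h₂ := h.adj_triangle.2.1
    have h₃ := h.adj_triangle.2.2.1
    refine ⟨.cons h₁ (.cons h₂ (.cons h₃.symm .nil)), ?_, by simp, by simp [Sym2.eq_swap]⟩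
    simp [Walk.cons_isCycle_iff, h₁.ne, h₁.ne', h₂.ne, h₃.ne, h₃.ne']
  obtain ⟨c₁, hc₁, hs₁, he₁⟩ := key h
  obtain ⟨c₂, hc₂, hs₂, he₂⟩ := key h.symm
  have hc : G.IsCyclePairAt c₁ c₂ := by
    refine ⟨hG, hcard, hc₁, hc₂, fun v hv hv' => ?_⟩
    simp only [hs₁, hs₂, List.mem_cons, List.not_mem_nil, or_false] at hv hv'
    rcases hv with rfl | rfl | rfl | rfl
    · rfl
    all_goals simp_all
  obtain ⟨hsum, hR⟩ := hc.ABCGG_eq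
  have hval : ∀ e ∈ G.edgeFinset \ (c₁.edges.toFinset ∪ c₂.edges.toFinset),
      edgeValue G e = pendentTerm (Fintype.card V) := by
    intro e he
    have hrel : ∀ p q, extremalRel u x y x' a b a' p q → s(p, q) ∉ c₁.edges → s(p, q) ∉ c₂.edges →
        edgeValue G s(p, q) = pendentTerm (Fintype.card V) := by
      intro p q hpq n₁ n₂
      have hadj : G.Adj p q := (h.adj_iff p q).2 (.inl hpq)
      rw [Sym2.eq_swap]
      refine hG.edgeValue_of_pendent hadj.symm fun r hr => ?_
      simp only [he₁, he₂, List.mem_cons, List.not_mem_nil, or_false, not_or] at n₁ n₂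
      rcases hpq with ⟨rfl, rfl⟩ | ⟨rfl, rfl⟩ | ⟨rfl, rfl⟩ | ⟨rfl, rfl⟩ | ⟨rfl, rfl⟩ | ⟨rfl, rfl⟩ |
        ⟨rfl, rfl⟩ | ⟨rfl, rfl⟩ | ⟨rfl, hq⟩
      · exact absurd rfl n₁.1
      · exact absurd rfl n₁.2.1
      · exact absurd Sym2.eq_swap n₁.2.2
      · exact absurd rfl n₂.1
      · exact absurd rfl n₂.2.1
      · exact absurd Sym2.eq_swap n₂.2.2
      · exact h.eq_of_adj_left hr
      · exact h.symm.eq_of_adj_left hr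
      · exact h.eq_of_adj hq hr
    induction e with | h p q
    simp only [Finset.mem_sdiff, mem_edgeFinset, mem_edgeSet, Finset.mem_union, List.mem_toFinset,
      not_or] at he
    rcases (h.adj_iff p q).1 he.1 with hpq | hpq
    · exact hrel p q hpq he.2.1 he.2.2
    · rw [Sym2.eq_swap] at he ⊢
      exact hrel q p hpq he.2.1 he.2.2
  have hl₁ : c₁.length = 3 := by rw [← Walk.length_edges, he₁]; rfl
  have hl₂ : c₂.length = 3 := by rw [← Walk.length_edges, he₂]; rfl
  have hT₁ := h.edgeValue_add_add hc (by simp [he₁]) (by simp [he₁]) (by simp [he₁])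
  have hT₂ := h.symm.edgeValue_add_add hc.symm (by simp [he₂]) (by simp [he₂]) (by simp [he₂])
  have hR' : ((G.edgeFinset \ (c₁.edges.toFinset ∪ c₂.edges.toFinset)).card : ℝ) =
      (Fintype.card V : ℝ) - 5 := by
    rw [eq_sub_iff_add_eq]
    exact_mod_cast (by omega)
  rw [hsum, Finset.sum_congr rfl hval, Finset.sum_const, nsmul_eq_mul, hR',
    List.sum_toFinset _ hc₁.edges_nodup, List.sum_toFinset _ hc₂.edges_nodup, he₁, he₂]
  simp only [List.map_cons, List.map_nil, List.sum_cons, List.sum_nil]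
  linarith

end SimpleGraph.IsExtremalLabelling

end Converse

section Main

variable {V : Type*} [Fintype V] {G : SimpleGraph V}

theorem InSnrt.exists_isCyclePairAt {n r t : ℕ} (hG : InSnrt G n r t) :
    ∃ (u : V) (c₁ c₂ : G.Walk u u), G.IsCyclePairAt c₁ c₂ := by
  classical
  obtain ⟨hcard, hconn, hedge, p, q, c₁, c₂, hc₁, hc₂, -, -, hint⟩ := hG
  obtain ⟨u, hu⟩ := Set.ncard_eq_one.1 hint
  have hmem : ∀ v, (v ∈ c₁.support ∧ v ∈ c₂.support) ↔ v = u := fun v => Set.ext_iff.1 hu v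
  obtain ⟨hu₁, hu₂⟩ := (hmem u).2 rfl
  refine ⟨u, c₁.rotate u hu₁, c₂.rotate u hu₂, hconn, by rw [hedge, hcard], hc₁.rotate hu₁,
    hc₂.rotate hu₂, fun v h₁ h₂ => (hmem v).1 ?_⟩
  rw [SimpleGraph.Walk.mem_support_rotate_iff] at h₁ h₂
  exact ⟨h₁, h₂⟩

theorem SimpleGraph.IsCyclePairAt.exists_isExtremalLabelling {u : V} {c₁ c₂ : G.Walk u u}
    (h : G.IsCyclePairAt c₁ c₂) (hn : 16 ≤ Fintype.card V)
    (heq : ABCGG G = 2 * triangleTerm (Fintype.card V) +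
      ((Fintype.card V : ℝ) - 5) * pendentTerm (Fintype.card V)) :
    ∃ x y x' a b a', G.IsExtremalLabelling u x y x' a b a' := by
  obtain ⟨⟨x, y, h₁, hx, hy⟩, ⟨a, b, h₂, ha, hb⟩, hleaf⟩ := (h.ABCGG_le hn).2 heq
  have ux : s(u, x) ∈ c₁.edges := (h₁ _).2 (.inl rfl)
  have xy : s(x, y) ∈ c₁.edges := (h₁ _).2 (.inr (.inl rfl))
  have uy : s(u, y) ∈ c₁.edges := (h₁ _).2 (.inr (.inr rfl))
  have ua : s(u, a) ∈ c₂.edges := (h₂ _).2 (.inl rfl)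
  have ab : s(a, b) ∈ c₂.edges := (h₂ _).2 (.inr (.inl rfl))
  have ub : s(u, b) ∈ c₂.edges := (h₂ _).2 (.inr (.inr rfl))
  have hne : ∀ v w, s(u, v) ∈ c₁.edges → s(u, w) ∈ c₂.edges → v ≠ w := by
    rintro v _ hv hw rfl
    exact (c₁.adj_of_mem_edges hv).ne' (h.eq_of_mem v (c₁.snd_mem_support_of_mem_edges hv)
      (c₂.snd_mem_support_of_mem_edges hw))
  obtain ⟨x', a', hlab⟩ := h.connected.isExtremalLabelling_of_sideCount (c₁.adj_of_mem_edges ux)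
    (c₁.adj_of_mem_edges xy) (c₁.adj_of_mem_edges uy) (c₂.adj_of_mem_edges ua)
    (c₂.adj_of_mem_edges ab) (c₂.adj_of_mem_edges ub) (hne x a ux ua) (hne x b ux ub)
    (hne y a uy ua) (hne y b uy ub) hx hy ha hb fun p q hpq => by
      have hmem : ∀ {v w : V}, s(p, q) = s(u, v) ∨ s(p, q) = s(v, w) ∨ s(p, q) = s(u, w) →
          p ∈ [u, v, w] ∧ q ∈ [u, v, w] := by
        intro v w h
        simp only [Sym2.eq_iff] at h
        rcases h with (⟨rfl, rfl⟩ | ⟨rfl, rfl⟩) | (⟨rfl, rfl⟩ | ⟨rfl, rfl⟩) |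
          (⟨rfl, rfl⟩ | ⟨rfl, rfl⟩) <;> simp
      by_cases n₁ : s(p, q) ∈ c₁.edges
      · exact .inl (hmem ((h₁ _).1 n₁))
      by_cases n₂ : s(p, q) ∈ c₂.edges
      · exact .inr (.inl (hmem ((h₂ _).1 n₂)))
      exact .inr (.inr (hleaf p q hpq n₁ n₂))
  exact ⟨x, y, x', a, b, a', hlab⟩

end Main

theorem stmt15 {V : Type*} [Fintype V] (G : SimpleGraph V) (n r t : ℕ)
    (hn : 16 ≤ n) (hr : 3 ≤ r) (ht : 3 ≤ t) (hG : InSnrt G n r t) :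
    ABCGG G ≤ 2 * (Real.sqrt 2 + Real.sqrt (((n : ℝ) - 4) / ((n : ℝ) - 3))) +
      ((n : ℝ) - 5) * Real.sqrt (((n : ℝ) - 2) / ((n : ℝ) - 1)) ∧
    (ABCGG G = 2 * (Real.sqrt 2 + Real.sqrt (((n : ℝ) - 4) / ((n : ℝ) - 3))) +
        ((n : ℝ) - 5) * Real.sqrt (((n : ℝ) - 2) / ((n : ℝ) - 1)) ↔
      Nonempty (G ≃g S33 1 0 1 0 (n - 7))) := by
  obtain ⟨u, c₁, c₂, h⟩ := hG.exists_isCyclePairAt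
  obtain ⟨rfl, -⟩ := hG
  refine ⟨(h.ABCGG_le hn).1, fun heq => ?_, fun ⟨f⟩ => ?_⟩
  · obtain ⟨x, y, x', a, b, a', hlab⟩ := h.exists_isExtremalLabelling hn heq
    refine hlab.nonempty_iso (Fintype.equivOfCardEq ?_)
      (SimpleGraph.IsExtremalLabelling.s33 (Fintype.card V - 7))
    simp only [Fintype.card_sum, Fintype.card_fin]
    omega
  · exact ((SimpleGraph.IsExtremalLabelling.s33 _).map f.symm).ABCGG_eq h.connected h.ncard_edgeSet
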